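/- arXiv:0906.4935 — 6 statements merged into one kernel-verified Lean document; each statement's English description precedes it below -/
import Mathlib

section
/- Let n ≥ 1, let r > 0, and let F : B(0,r) → ℂ be holomorphic on the open ball B(0,r) ⊆ ℂⁿ and not identically zero. Then for Lebesgue-almost every vector v ∈ ℂⁿ, the one-variable function t ↦ F(t·v), defined on the open set {t ∈ ℂ : t·v ∈ B(0,r)}, is not identically zero. -/
open MeasureTheory

open Filter Topology

/-- An analytic function on a preconnected open set of `ℂ` that does not vanish identically is
almost everywhere nonzero there. -/
theorem ae_ne_zero_of_analyticOnNhd {U : Set ℂ} {g : ℂ → ℂ} (hg : AnalyticOnNhd ℂ g U)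
    (hU : IsPreconnected U) (hUo : IsOpen U) {x : ℂ} (hx : x ∈ U) (hgx : g x ≠ 0) :
    ∀ᵐ s : ℂ, s ∈ U → g s ≠ 0 := by
  rw [← ae_restrict_iff' hUo.measurableSet]
  refine ae_restrict_le_codiscreteWithin hUo.measurableSet ?_
  exact (hg.eqOn_zero_or_eventually_ne_zero_of_preconnected hU).resolve_left
    fun h ↦ hgx (h hx)

section

variable {E : Type*} [NormedAddCommGroup E] [NormedSpace ℂ E] {F : E → ℂ} {r : ℝ}

/-- The set of directions along which `F` does not vanish identically is open. -/
theorem isOpen_setOf_slice_ne_zero (hF : ContinuousOn F (Metric.ball 0 r)) :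
    IsOpen {v : E | ¬ ∀ t : ℂ, t • v ∈ Metric.ball (0 : E) r → F (t • v) = 0} := by
  have hW : IsOpen (Metric.ball (0 : E) r ∩ F ⁻¹' {0}ᶜ) :=
    hF.isOpen_inter_preimage Metric.isOpen_ball isOpen_compl_singleton
  have heq : {v : E | ¬ ∀ t : ℂ, t • v ∈ Metric.ball (0 : E) r → F (t • v) = 0} =
      ⋃ t : ℂ, (fun v : E ↦ t • v) ⁻¹' (Metric.ball (0 : E) r ∩ F ⁻¹' {0}ᶜ) := by
    ext v
    simp
  rw [heq]
  exact isOpen_iUnion fun t ↦ hW.preimage (continuous_const_smul t)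

/-- On every affine line in the direction of a point `z` with `F z ≠ 0`, almost every point is a
direction along which `F` does not vanish identically. -/
theorem ae_slice_ne_zero_on_line (hF : AnalyticOnNhd ℂ F (Metric.ball 0 r)) {z : E}
    (hz : z ∈ Metric.ball 0 r) (hFz : F z ≠ 0) (v : E) :
    ∀ᵐ s : ℂ, ¬ ∀ t : ℂ, t • (v + s • z) ∈ Metric.ball (0 : E) r → F (t • (v + s • z)) = 0 := by
  have htend (a b : E) : Tendsto (fun m : ℕ ↦ a + ((m : ℂ)⁻¹) • b) atTop (𝓝 a) := by
    simpa using tendsto_const_nhds.add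
      ((tendsto_inv_atTop_nhds_zero_nat (𝕜 := ℂ)).smul (tendsto_const_nhds (x := b)))
  have hW : IsOpen (Metric.ball (0 : E) r ∩ F ⁻¹' {0}ᶜ) :=
    hF.continuousOn.isOpen_inter_preimage Metric.isOpen_ball isOpen_compl_singleton
  have hlarge : ∀ᶠ m : ℕ in atTop, z + ((m : ℂ)⁻¹) • v ∈ Metric.ball (0 : E) r ∩ F ⁻¹' {0}ᶜ :=
    (htend z v).eventually (hW.mem_nhds ⟨hz, hFz⟩)
  have hae : ∀ᵐ s : ℂ, ∀ m : ℕ, m ≠ 0 →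
      z + ((m : ℂ)⁻¹) • v ∈ Metric.ball (0 : E) r ∩ F ⁻¹' {0}ᶜ →
      (m : ℂ)⁻¹ • (v + s • z) ∈ Metric.ball (0 : E) r → F ((m : ℂ)⁻¹ • (v + s • z)) ≠ 0 := by
    refine ae_all_iff.2 fun m ↦ ae_all_iff.2 fun hm ↦ ae_all_iff.2 fun hmW ↦ ?_
    have hm' : (m : ℂ) ≠ 0 := Nat.cast_ne_zero.2 hm
    let L : ℂ → E := fun s ↦ (m : ℂ)⁻¹ • (v + s • z)
    have hL : Differentiable ℂ L := by fun_prop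
    have hLm : L m = z + (m : ℂ)⁻¹ • v := by
      simp [L, smul_add, smul_smul, hm', add_comm]
    have hLa : ∀ s, AnalyticAt ℂ L s := fun s ↦ by fun_prop
    have hconv : Convex ℝ (L ⁻¹' Metric.ball (0 : E) r) := by
      intro s hs t ht a b ha hb hab
      have hLab : L (a • s + b • t) = a • L s + b • L t := by
        have hab' : (a : ℂ) + b = 1 := mod_cast hab
        have hv : v = (a : ℂ) • v + (b : ℂ) • v := by rw [← add_smul, hab', one_smul]
        simp only [L, ← Complex.coe_smul, smul_eq_mul]
        nth_rewrite 1 [hv]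
        module
      rw [Set.mem_preimage, hLab]
      exact convex_ball (0 : E) r hs ht ha hb hab
    exact ae_ne_zero_of_analyticOnNhd (g := F ∘ L)
      (fun s hs ↦ (hF (L s) hs).comp (f := L) (hLa s)) hconv.isPreconnected
      (Metric.isOpen_ball.preimage hL.continuous) (x := (m : ℂ))
      (Set.mem_preimage.2 (hLm ▸ hmW.1))
      (by rw [Function.comp_apply, hLm]; exact hmW.2)
  filter_upwards [hae] with s hs hzero
  have hr : 0 < r := Metric.pos_of_mem_ball hz
  obtain ⟨m, hmW, hm, hmb⟩ := (hlarge.and ((eventually_ne_atTop 0).and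
    ((htend 0 (v + s • z)).eventually (Metric.ball_mem_nhds 0 hr)))).exists
  rw [zero_add] at hmb
  exact hs m hm hmW hmb (hzero _ hmb)

end

/-- Let `n ≥ 1`, `r > 0`, and let `F` be holomorphic on the open ball `B(0,r) ⊆ ℂⁿ` and not
identically zero there. Then for Lebesgue-almost every vector `v ∈ ℂⁿ`, the one-variable
function `t ↦ F (t • v)`, defined on `{t : ℂ | t • v ∈ B(0,r)}`, is not identically zero. -/
theorem ae_direction_slice_not_identically_zero (n : ℕ) (hn : 1 ≤ n) (r : ℝ) (hr : 0 < r)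
    (F : (Fin n → ℂ) → ℂ)
    (hF : ∀ z ∈ Metric.ball (0 : Fin n → ℂ) r, AnalyticAt ℂ F z)
    (hFne : ¬ ∀ z ∈ Metric.ball (0 : Fin n → ℂ) r, F z = 0) :
    ∀ᵐ v : Fin n → ℂ, ¬ ∀ t : ℂ, t • v ∈ Metric.ball (0 : Fin n → ℂ) r → F (t • v) = 0 := by
  push Not at hFne
  obtain ⟨z, hz, hFz⟩ := hFne
  exact ae_mem_of_ae_add_linearMap_mem (LinearMap.toSpanSingleton ℂ (Fin n → ℂ) z) volume volume
    (isOpen_setOf_slice_ne_zero (AnalyticOnNhd.continuousOn hF)).measurableSet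
    (ae_slice_ne_zero_on_line hF hz hFz)
end

section
/- Let n ≥ 1, let r > 0, and let F₁, …, F_m : B(0,r) → ℂ be finitely many functions, each holomorphic on the open ball B(0,r) ⊆ ℂⁿ and each not identically zero. Then for Lebesgue-almost every vector v ∈ ℂⁿ, simultaneously for every j ∈ {1, …, m}, the one-variable function t ↦ F_j(t·v), defined on {t ∈ ℂ : t·v ∈ B(0,r)}, is not identically zero. -/
open MeasureTheory

/-- The zero set of an analytic function which does not vanish identically on a convex open set is
Lebesgue-null. -/
theorem AnalyticOnNhd.measure_zeros_eq_zero_of_convex {E G : Type*} [NormedAddCommGroup E]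
    [NormedSpace ℝ E] [FiniteDimensional ℝ E] [MeasurableSpace E] [BorelSpace E]
    [NormedAddCommGroup G] [NormedSpace ℝ G] (μ : Measure E) [μ.IsAddHaarMeasure]
    {U : Set E} {f : E → G} (hf : AnalyticOnNhd ℝ f U) (hU : IsOpen U) (hUc : Convex ℝ U)
    {a : E} (ha : a ∈ U) (hfa : f a ≠ 0) : μ (U ∩ f ⁻¹' {0}) = 0 := by
  have hmeas : MeasurableSet (U ∩ f ⁻¹' {0}) := by
    have hopen : IsOpen (U ∩ f ⁻¹' {0}ᶜ) :=
      hf.continuousOn.isOpen_inter_preimage hU isOpen_compl_singleton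
    have heq : U ∩ f ⁻¹' {0} = U \ (U ∩ f ⁻¹' {0}ᶜ) := by
      ext x
      simp only [Set.mem_inter_iff, Set.mem_preimage, Set.mem_singleton_iff, Set.mem_sdiff,
        Set.mem_compl_iff]
      tauto
    rw [heq]
    exact hU.measurableSet.diff hopen.measurableSet
  set T : Set E := (fun w ↦ a + w) ⁻¹' (U ∩ f ⁻¹' {0}) with hT
  have hTmeas : MeasurableSet T := hmeas.preimage (measurable_const_add a)
  have hline : ∀ w : E, ∀ᵐ s : ℝ, s • w ∉ T := by
    intro w
    have hcont : Continuous fun s : ℝ ↦ a + s • w := by fun_prop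
    set V : Set ℝ := (fun s : ℝ ↦ a + s • w) ⁻¹' U with hV
    have hVopen : IsOpen V := hU.preimage hcont
    have hVconv : Convex ℝ V := by
      intro x hx y hy b c hb hc hbc
      have h := hUc hx hy hb hc hbc
      have heq : b • (a + x • w) + c • (a + y • w) = a + (b • x + c • y) • w := by
        calc b • (a + x • w) + c • (a + y • w)
            = (b + c) • a + (b • x + c • y) • w := by module
          _ = a + (b • x + c • y) • w := by rw [hbc, one_smul]
      simpa only [hV, Set.mem_preimage, heq] using h
    have hg : AnalyticOnNhd ℝ (fun s : ℝ ↦ f (a + s • w)) V := fun s hs ↦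
      AnalyticAt.fun_comp (g := f) (f := fun s : ℝ ↦ a + s • w) (hf _ hs) (by fun_prop)
    have h0 : (0 : ℝ) ∈ V := by simpa [hV] using ha
    have hcod := hg.preimage_zero_mem_codiscreteWithin (x := 0) (by simpa using hfa) h0
      ⟨⟨0, h0⟩, hVconv.isPreconnected⟩
    have hae := ae_restrict_le_codiscreteWithin (μ := volume) hVopen.measurableSet hcod
    filter_upwards [(ae_restrict_iff' hVopen.measurableSet).1 hae] with s hs hsT
    exact hs hsT.1 hsT.2
  have hcomm : ∀ᵐ s : ℝ, ∀ᵐ w ∂μ, s • w ∉ T :=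
    (Measure.ae_ae_comm (μ := μ) (ν := volume) (p := fun w (s : ℝ) ↦ s • w ∉ T)
      (hTmeas.compl.preimage (by fun_prop : Measurable fun x : E × ℝ ↦ x.2 • x.1))).1
      (Filter.Eventually.of_forall hline)
  obtain ⟨s, hs, hs0⟩ := (hcomm.and (Measure.ae_ne volume (0 : ℝ))).exists
  have hTnull : μ ((s • ·) ⁻¹' T) = 0 := measure_eq_zero_iff_ae_notMem.2 hs
  rw [Measure.addHaar_preimage_smul μ hs0, mul_eq_zero] at hTnull
  have hTzero : μ T = 0 := hTnull.resolve_left (by simp; positivity)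
  rwa [hT, measure_preimage_add] at hTzero

/-- Let `n ≥ 1`, `r > 0`, and let `F 1, …, F m` be finitely many functions, each holomorphic
on the open ball `B(0,r) ⊆ ℂⁿ` and each not identically zero. Then for Lebesgue-almost every
vector `v ∈ ℂⁿ`, simultaneously for every `j`, the one-variable function `t ↦ F j (t • v)`,
defined on `{t : ℂ | t • v ∈ B(0,r)}`, is not identically zero. -/
theorem ae_direction_slices_not_identically_zero (n : ℕ) (hn : 1 ≤ n) (r : ℝ) (hr : 0 < r)
    (m : ℕ) (F : Fin m → (Fin n → ℂ) → ℂ)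
    (hF : ∀ j, ∀ z ∈ Metric.ball (0 : Fin n → ℂ) r, AnalyticAt ℂ (F j) z)
    (hFne : ∀ j, ¬ ∀ z ∈ Metric.ball (0 : Fin n → ℂ) r, F j z = 0) :
    ∀ᵐ v : Fin n → ℂ, ∀ j,
      ¬ ∀ t : ℂ, t • v ∈ Metric.ball (0 : Fin n → ℂ) r → F j (t • v) = 0 := by
  rw [ae_all_iff]
  intro j
  obtain ⟨a, ha, hfa⟩ : ∃ a ∈ Metric.ball (0 : Fin n → ℂ) r, F j a ≠ 0 := by
    simpa using hFne j
  have hreal : AnalyticOnNhd ℝ (F j) (Metric.ball 0 r) :=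
    fun z hz ↦ (hF j z hz).restrictScalars
  have hnull := hreal.measure_zeros_eq_zero_of_convex volume Metric.isOpen_ball
    (convex_ball _ _) ha hfa
  have hscale : ∀ k : ℕ, ∀ᵐ v : Fin n → ℂ,
      ((k : ℝ) + 1)⁻¹ • v ∉ Metric.ball (0 : Fin n → ℂ) r ∩ F j ⁻¹' {0} := by
    intro k
    have hk : ((k : ℝ) + 1)⁻¹ ≠ 0 := by positivity
    have h := Measure.addHaar_preimage_smul (volume : Measure (Fin n → ℂ)) hk
      (Metric.ball (0 : Fin n → ℂ) r ∩ F j ⁻¹' {0})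
    rw [hnull, mul_zero] at h
    exact measure_eq_zero_iff_ae_notMem.1 h
  filter_upwards [ae_all_iff.2 hscale] with v hv hzero
  obtain ⟨k, hk⟩ := exists_nat_gt (‖v‖ / r)
  have hmem : ((k : ℝ) + 1)⁻¹ • v ∈ Metric.ball (0 : Fin n → ℂ) r := by
    have hk' : ‖v‖ < k * r := (div_lt_iff₀ hr).1 hk
    rw [mem_ball_zero_iff, norm_smul, norm_inv, Real.norm_of_nonneg (by positivity),
      inv_mul_lt_iff₀ (by positivity)]
    linarith
  have hcast : (((((k : ℝ) + 1)⁻¹ : ℝ) : ℂ)) • v = ((k : ℝ) + 1)⁻¹ • v :=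
    Complex.coe_smul _ v
  refine hv k ⟨hmem, ?_⟩
  have h := hzero (((k : ℝ) + 1)⁻¹ : ℝ) (by rwa [hcast])
  rwa [hcast] at h
end

section
/- Let U ⊆ ℂ be a convex open set, let 0 ≤ ε < 1, and let ξ : U → ℂ be holomorphic with ξ'(a) ≠ 0 for all a ∈ U and |ξ'(a)/ξ'(b) − 1| ≤ ε for all a, b ∈ U. Then ξ is injective on U. -/
open MeasureTheory

/-- Let `U ⊆ ℂ` be a convex open set, `0 ≤ ε < 1`, and let `ξ : U → ℂ` be holomorphic with
nonvanishing derivative and `|ξ'(a)/ξ'(b) - 1| ≤ ε` for all `a, b ∈ U`. Then `ξ` is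
injective on `U`. -/
theorem injective_of_small_argument_distortion (U : Set ℂ)
    (hUconv : Convex ℝ U) (hUopen : IsOpen U)
    (ε : ℝ) (hε0 : 0 ≤ ε) (hε1 : ε < 1)
    (ξ ξ' : ℂ → ℂ)
    (hderiv : ∀ a ∈ U, HasDerivAt ξ (ξ' a) a)
    (hne : ∀ a ∈ U, ξ' a ≠ 0)
    (hdist : ∀ a ∈ U, ∀ b ∈ U, ‖ξ' a / ξ' b - 1‖ ≤ ε) :
    Set.InjOn ξ U := by
  intro x hx y hy hxy
  have hlip := Convex.norm_image_sub_le_of_norm_hasDerivWithin_le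
    (f := fun z => ξ z / ξ' x - z) (f' := fun z => ξ' z / ξ' x - 1)
    (fun z hz => (((hderiv z hz).div_const _).sub (hasDerivAt_id z)).hasDerivWithinAt)
    (fun z hz => hdist z hz x hx) hUconv hx hy
  simp only [hxy, sub_sub_sub_cancel_left] at hlip
  rw [norm_sub_rev] at hlip
  have hzero : ‖y - x‖ = 0 := by nlinarith [norm_nonneg (y - x)]
  exact (sub_eq_zero.mp (norm_eq_zero.mp hzero)).symm
end

section
/- Let a₀ ∈ ℂ, r₀ > 0, let 0 ≤ ε < 1, and let ξ : B(a₀, r₀) → ℂ be holomorphic on the open disk B(a₀, r₀) with ξ'(a) ≠ 0 for all a and |ξ'(a)/ξ'(b) − 1| ≤ ε for all a, b ∈ B(a₀, r₀). Then the image ξ(B(a₀, r₀)) contains the open disk of radius (1 − ε)·|ξ'(a₀)|·r₀ centered at ξ(a₀), and is contained in the closed disk of radius (1 + ε)·|ξ'(a₀)|·r₀ centered at ξ(a₀). -/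
open MeasureTheory

/-- A function on a convex set whose derivative stays within `C` of `m` is approximated there by
multiplication by `m`. -/
theorem approximatesLinearOn_toSpanSingleton_of_norm_deriv_sub_le {ξ ξ' : ℂ → ℂ} {s : Set ℂ}
    {m : ℂ} {C : NNReal} (hs : Convex ℝ s) (hderiv : ∀ a ∈ s, HasDerivAt ξ (ξ' a) a)
    (hbound : ∀ a ∈ s, ‖ξ' a - m‖ ≤ C) :
    ApproximatesLinearOn ξ (ContinuousLinearMap.toSpanSingleton ℂ m) s C := by
  intro x hx y hy
  refine hs.norm_image_sub_le_of_norm_hasFDerivWithin_le'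
    (f' := fun a => ContinuousLinearMap.toSpanSingleton ℂ (ξ' a))
    (fun a ha => (hderiv a ha).hasFDerivAt.hasFDerivWithinAt) (fun a ha => ?_) hy hx
  have hsub : ContinuousLinearMap.toSpanSingleton ℂ (ξ' a) -
      ContinuousLinearMap.toSpanSingleton ℂ m =
      ContinuousLinearMap.toSpanSingleton ℂ (ξ' a - m) := by
    ext
    simp
  rw [hsub, ContinuousLinearMap.norm_toSpanSingleton]
  exact hbound a ha

/-- Division by a nonzero `m` as a right inverse of multiplication by `m`. -/
noncomputable def divNonlinearRightInverse {m : ℂ} (hm : m ≠ 0) :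
    (ContinuousLinearMap.toSpanSingleton ℂ m).NonlinearRightInverse where
  toFun y := y / m
  nnnorm := ‖m‖₊⁻¹
  bound' y := by simp [div_eq_inv_mul]
  right_inv' y := by simp [hm]

/-- Let `ξ` be holomorphic on the open disk `B(a₀, r₀)` with nonvanishing derivative and
`|ξ'(a)/ξ'(b) - 1| ≤ ε < 1` for all `a, b` in the disk. Then the image `ξ (B(a₀, r₀))`
contains the open disk of radius `(1 - ε) * |ξ'(a₀)| * r₀` centered at `ξ a₀`, and is
contained in the closed disk of radius `(1 + ε) * |ξ'(a₀)| * r₀` centered at `ξ a₀`. -/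
theorem image_of_disk_under_small_distortion (a₀ : ℂ) (r₀ : ℝ) (hr₀ : 0 < r₀)
    (ε : ℝ) (hε0 : 0 ≤ ε) (hε1 : ε < 1)
    (ξ ξ' : ℂ → ℂ)
    (hderiv : ∀ a ∈ Metric.ball a₀ r₀, HasDerivAt ξ (ξ' a) a)
    (hne : ∀ a ∈ Metric.ball a₀ r₀, ξ' a ≠ 0)
    (hdist : ∀ a ∈ Metric.ball a₀ r₀, ∀ b ∈ Metric.ball a₀ r₀, ‖ξ' a / ξ' b - 1‖ ≤ ε) :
    Metric.ball (ξ a₀) ((1 - ε) * ‖ξ' a₀‖ * r₀) ⊆ ξ '' Metric.ball a₀ r₀ ∧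
      ξ '' Metric.ball a₀ r₀ ⊆ Metric.closedBall (ξ a₀) ((1 + ε) * ‖ξ' a₀‖ * r₀) := by
  have ha₀ : a₀ ∈ Metric.ball a₀ r₀ := Metric.mem_ball_self hr₀
  have hm := hne a₀ ha₀
  have hm_pos : 0 < ‖ξ' a₀‖ := norm_pos_iff.2 hm
  have happrox : ApproximatesLinearOn ξ (ContinuousLinearMap.toSpanSingleton ℂ (ξ' a₀))
      (Metric.ball a₀ r₀) (.mk (ε * ‖ξ' a₀‖) (by positivity)) := by
    refine approximatesLinearOn_toSpanSingleton_of_norm_deriv_sub_le (convex_ball a₀ r₀) hderiv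
      fun a ha => ?_
    have h := hdist a ha a₀ ha₀
    rwa [div_sub_one hm, norm_div, div_le_iff₀ hm_pos] at h
  constructor
  · intro w hw
    have hpos : 0 < (1 - ε) * ‖ξ' a₀‖ := mul_pos (by linarith) hm_pos
    have hρ : dist w (ξ a₀) / ((1 - ε) * ‖ξ' a₀‖) < r₀ := by
      rwa [div_lt_iff₀' hpos]
    have hsub := Metric.closedBall_subset_ball (x := a₀) hρ
    obtain ⟨z, hz, rfl⟩ := happrox.surjOn_closedBall_of_nonlinearRightInverse
      (divNonlinearRightInverse hm) (by positivity) hsub (a := w) (by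
        have hrad : (((divNonlinearRightInverse hm).nnnorm : ℝ)⁻¹ - ε * ‖ξ' a₀‖) =
            (1 - ε) * ‖ξ' a₀‖ := by
          simp only [divNonlinearRightInverse, NNReal.coe_inv, coe_nnnorm, inv_inv]
          ring
        rw [Metric.mem_closedBall, NNReal.coe_mk, hrad, mul_div_cancel₀ _ hpos.ne'])
    exact ⟨z, hsub hz, rfl⟩
  · rintro _ ⟨z, hz, rfl⟩
    have h := happrox z hz a₀ ha₀
    rw [NNReal.coe_mk, ContinuousLinearMap.toSpanSingleton_apply, smul_eq_mul] at h
    rw [Metric.mem_closedBall, dist_eq_norm]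
    have hz' : ‖z - a₀‖ ≤ r₀ := (mem_ball_iff_norm.1 hz).le
    calc ‖ξ z - ξ a₀‖
        ≤ ‖(z - a₀) * ξ' a₀‖ + ‖ξ z - ξ a₀ - (z - a₀) * ξ' a₀‖ := norm_le_norm_add_norm_sub' _ _
      _ ≤ ‖z - a₀‖ * ‖ξ' a₀‖ + ε * ‖ξ' a₀‖ * ‖z - a₀‖ := by
        rw [norm_mul]
        gcongr
      _ = (1 + ε) * ‖ξ' a₀‖ * ‖z - a₀‖ := by ring
      _ ≤ (1 + ε) * ‖ξ' a₀‖ * r₀ := by gcongr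
end

section
/- Let a₀ ∈ ℂ, r₀ > 0, let 0 ≤ ε ≤ 1/2, let S > 0, and let ξ : B(a₀, r₀) → ℂ be holomorphic on the open disk B(a₀, r₀) with ξ'(a) ≠ 0 for all a and |ξ'(a)/ξ'(b) − 1| ≤ ε for all a, b ∈ B(a₀, r₀). If the diameter of the image ξ(B(a₀, r₀)) is at least S, then ξ(B(a₀, r₀)) contains an open disk of radius (1 − ε)·S / (2·(1 + ε)); in particular it contains an open disk of diameter S/3. -/
open MeasureTheory

/-- A map whose derivative stays within distance `c < ‖L‖` of a nonzero constant `L` on a disk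
of radius `r` has image containing the concentric disk of radius `(‖L‖ - c) * r`. -/
theorem ball_subset_image_of_norm_deriv_sub_le {f f' : ℂ → ℂ} {a L : ℂ} {r c : ℝ}
    (hc : 0 ≤ c) (hcL : c < ‖L‖)
    (hf : ∀ z ∈ Metric.ball a r, HasDerivAt f (f' z) z)
    (hbound : ∀ z ∈ Metric.ball a r, ‖f' z - L‖ ≤ c) :
    Metric.ball (f a) ((‖L‖ - c) * r) ⊆ f '' Metric.ball a r := by
  have hL : L ≠ 0 := norm_pos_iff.1 (hc.trans_lt hcL)
  have hLc : 0 < ‖L‖ - c := sub_pos.2 hcL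
  let A : ℂ →L[ℂ] ℂ := ContinuousLinearMap.toSpanSingleton ℂ L
  have happrox : ApproximatesLinearOn f A (Metric.ball a r) ⟨c, hc⟩ := by
    intro x hx y hy
    have h := (convex_ball a r).norm_image_sub_le_of_norm_hasDerivWithin_le
      (f := fun z => f z - z * L) (f' := fun z => f' z - L) (C := c)
      (fun z hz => ((hf z hz).sub (hasDerivAt_mul_const L)).hasDerivWithinAt)
      hbound hy hx
    have heq : f x - f y - A (x - y) = f x - x * L - (f y - y * L) := by
      simp only [A, ContinuousLinearMap.toSpanSingleton_apply, smul_eq_mul]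
      ring
    rw [heq]
    exact h
  let B : A.NonlinearRightInverse :=
    { toFun := fun w => w / L
      nnnorm := ‖L‖₊⁻¹
      bound' := fun w => by simp [div_eq_inv_mul]
      right_inv' := fun w => by simp [A, hL] }
  intro w hw
  rw [mem_ball_iff_norm] at hw
  have hs : ‖w - f a‖ / (‖L‖ - c) < r := by
    rw [div_lt_iff₀ hLc, mul_comm]
    exact hw
  have hs0 : 0 ≤ ‖w - f a‖ / (‖L‖ - c) := by positivity
  have hsub : Metric.closedBall a (‖w - f a‖ / (‖L‖ - c)) ⊆ Metric.ball a r :=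
    Metric.closedBall_subset_ball hs
  obtain ⟨z, hz, rfl⟩ := happrox.surjOn_closedBall_of_nonlinearRightInverse B hs0 hsub
    (a := w) (by
      have hB : ((B.nnnorm : ℝ)⁻¹ - c) = ‖L‖ - c := by simp [B]
      rw [mem_closedBall_iff_norm]
      change _ ≤ ((B.nnnorm : ℝ)⁻¹ - c) * _
      rw [hB, mul_div_cancel₀ _ hLc.ne'])
  exact ⟨z, hsub hz, rfl⟩

/-- A function with derivative bounded by `C` on a disk of radius `r` has image of diameter at most
`C * (2 * r)`. -/
theorem diam_image_ball_le_of_norm_deriv_le {f f' : ℂ → ℂ} {a : ℂ} {r C : ℝ}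
    (hr : 0 ≤ r) (hC : 0 ≤ C)
    (hf : ∀ z ∈ Metric.ball a r, HasDerivAt f (f' z) z)
    (hbound : ∀ z ∈ Metric.ball a r, ‖f' z‖ ≤ C) :
    Metric.diam (f '' Metric.ball a r) ≤ C * (2 * r) := by
  refine Metric.diam_le_of_forall_dist_le (by positivity) ?_
  rintro _ ⟨x, hx, rfl⟩ _ ⟨y, hy, rfl⟩
  have h := (convex_ball a r).norm_image_sub_le_of_norm_hasDerivWithin_le
    (fun z hz => (hf z hz).hasDerivWithinAt) hbound hy hx
  rw [dist_eq_norm]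
  refine h.trans (mul_le_mul_of_nonneg_left ?_ hC)
  rw [← dist_eq_norm]
  linarith [dist_triangle_right x y a, Metric.mem_ball.1 hx, Metric.mem_ball.1 hy]

/-- Let `ξ` be holomorphic on the open disk `B(a₀, r₀)` with nonvanishing derivative and
`|ξ'(a)/ξ'(b) - 1| ≤ ε ≤ 1/2` for all `a, b` in the disk. If the image `ξ (B(a₀, r₀))`
has diameter at least `S`, then it contains an open disk of radius
`(1 - ε) * S / (2 * (1 + ε))`; in particular it contains an open disk of diameter `S/3`
(i.e. of radius `S/6`). -/
theorem image_contains_disk_of_large_diameter (a₀ : ℂ) (r₀ : ℝ) (hr₀ : 0 < r₀)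
    (ε S : ℝ) (hε0 : 0 ≤ ε) (hε1 : ε ≤ 1 / 2) (hS : 0 < S)
    (ξ ξ' : ℂ → ℂ)
    (hderiv : ∀ a ∈ Metric.ball a₀ r₀, HasDerivAt ξ (ξ' a) a)
    (hne : ∀ a ∈ Metric.ball a₀ r₀, ξ' a ≠ 0)
    (hdist : ∀ a ∈ Metric.ball a₀ r₀, ∀ b ∈ Metric.ball a₀ r₀, ‖ξ' a / ξ' b - 1‖ ≤ ε)
    (hdiam : S ≤ Metric.diam (ξ '' Metric.ball a₀ r₀)) :
    (∃ c : ℂ, Metric.ball c ((1 - ε) * S / (2 * (1 + ε))) ⊆ ξ '' Metric.ball a₀ r₀) ∧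
      (∃ c : ℂ, Metric.ball c (S / 6) ⊆ ξ '' Metric.ball a₀ r₀) := by
  have ha₀ : a₀ ∈ Metric.ball a₀ r₀ := Metric.mem_ball_self hr₀
  have hL : 0 < ‖ξ' a₀‖ := norm_pos_iff.2 (hne a₀ ha₀)
  have hclose : ∀ z ∈ Metric.ball a₀ r₀, ‖ξ' z - ξ' a₀‖ ≤ ε * ‖ξ' a₀‖ := by
    intro z hz
    have h := hdist z hz a₀ ha₀
    rwa [div_sub_one (hne a₀ ha₀), norm_div, div_le_iff₀ hL] at h
  have hbound : ∀ z ∈ Metric.ball a₀ r₀, ‖ξ' z‖ ≤ (1 + ε) * ‖ξ' a₀‖ := by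
    intro z hz
    linarith [hclose z hz, norm_le_norm_add_norm_sub' (ξ' z) (ξ' a₀)]
  have hSle : S ≤ (1 + ε) * ‖ξ' a₀‖ * (2 * r₀) :=
    hdiam.trans (diam_image_ball_le_of_norm_deriv_le hr₀.le (by positivity) hderiv hbound)
  have hball := ball_subset_image_of_norm_deriv_sub_le (by positivity : 0 ≤ ε * ‖ξ' a₀‖)
    (by nlinarith) hderiv hclose
  have hradius : (1 - ε) * S / (2 * (1 + ε)) ≤ (‖ξ' a₀‖ - ε * ‖ξ' a₀‖) * r₀ := by
    rw [div_le_iff₀ (by positivity)]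
    have h := mul_le_mul_of_nonneg_left hSle (by linarith : 0 ≤ 1 - ε)
    linarith
  have hsixth : S / 6 ≤ (1 - ε) * S / (2 * (1 + ε)) := by
    rw [div_le_div_iff₀ (by norm_num) (by positivity)]
    nlinarith
  exact ⟨⟨ξ a₀, (Metric.ball_subset_ball hradius).trans hball⟩,
    ⟨ξ a₀, (Metric.ball_subset_ball (hsixth.trans hradius)).trans hball⟩⟩
end

section
/- Let a₀ ∈ ℂ, r₀ > 0, let ε ≥ 0, and let ξ : B(a₀, r₀) → ℂ be holomorphic and injective on the open disk D₀ = B(a₀, r₀), with ξ'(a) ≠ 0 for all a ∈ D₀ and |ξ'(a)/ξ'(b) − 1| ≤ ε for all a, b ∈ D₀. Then for every Lebesgue-measurable set X ⊆ ξ(D₀), one has μ(ξ⁻¹(X)) ≥ (1 − (1 + ε)²·(1 − μ(X)/μ(ξ(D₀))))·μ(D₀), where μ denotes Lebesgue measure on ℂ. -/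
open MeasureTheory

/-- The real Jacobian determinant of multiplication by a complex number. -/
theorem abs_det_restrictScalars_toSpanSingleton (c : ℂ) :
    |((ContinuousLinearMap.toSpanSingleton ℂ c).restrictScalars ℝ).det| = ‖c‖ ^ 2 := by
  rw [ContinuousLinearMap.det, ContinuousLinearMap.coe_restrictScalars,
    LinearMap.det_restrictScalars]
  simp [Algebra.norm_complex_apply, Complex.normSq_eq_norm_sq]

/-- The area formula for holomorphic injections. -/
theorem volume_image_eq_lintegral_norm_deriv_sq {f f' : ℂ → ℂ} {s : Set ℂ}
    (hs : MeasurableSet s) (hf : ∀ a ∈ s, HasDerivAt f (f' a) a) (hinj : Set.InjOn f s) :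
    volume (f '' s) = ∫⁻ a in s, ENNReal.ofReal (‖f' a‖ ^ 2) := by
  rw [← lintegral_abs_det_fderiv_eq_addHaar_image volume hs
    (fun a ha => ((hf a ha).hasFDerivAt.restrictScalars ℝ).hasFDerivWithinAt) hinj]
  simp only [abs_det_restrictScalars_toSpanSingleton]

/-- If `w` varies over `s` by a factor of at most `K`, then its average over `s` is at most
`K` times its average over any subset `t`. -/
theorem measure_mul_setLIntegral_le_of_le_mul {α : Type*} [MeasurableSpace α] {μ : Measure α}
    {s t : Set α} {w : α → ENNReal} {K : ENNReal} (hs : MeasurableSet s) (ht : MeasurableSet t)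
    (hts : t ⊆ s) (hK : K ≠ ⊤) (hμs : μ s ≠ ⊤) (hw : ∀ a ∈ s, ∀ b ∈ s, w a ≤ K * w b) :
    μ t * ∫⁻ a in s, w a ∂μ ≤ K * μ s * ∫⁻ b in t, w b ∂μ := by
  have hb : ∀ b ∈ t, ∫⁻ a in s, w a ∂μ ≤ K * μ s * w b := fun b hb =>
    calc ∫⁻ a in s, w a ∂μ ≤ ∫⁻ _ in s, K * w b ∂μ :=
          setLIntegral_mono' hs fun a ha => hw a ha b (hts hb)
      _ = K * μ s * w b := by rw [setLIntegral_const]; ring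
  calc μ t * ∫⁻ a in s, w a ∂μ = ∫⁻ _ in t, ∫⁻ a in s, w a ∂μ ∂μ := by
        rw [setLIntegral_const, mul_comm]
    _ ≤ ∫⁻ b in t, K * μ s * w b ∂μ := setLIntegral_mono' ht hb
    _ = K * μ s * ∫⁻ b in t, w b ∂μ := lintegral_const_mul' _ _ (ENNReal.mul_ne_top hK hμs)

/-- Let `ξ` be holomorphic and injective on the open disk `D₀ = B(a₀, r₀)`, with
nonvanishing derivative and `|ξ'(a)/ξ'(b) - 1| ≤ ε` for all `a, b ∈ D₀`. Then for every
Lebesgue-measurable `X ⊆ ξ(D₀)`,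
`μ (ξ⁻¹ X) ≥ (1 - (1 + ε)² * (1 - μ X / μ (ξ(D₀)))) * μ D₀`. -/
theorem measure_preimage_of_small_distortion (a₀ : ℂ) (r₀ : ℝ) (hr₀ : 0 < r₀)
    (ε : ℝ) (hε0 : 0 ≤ ε)
    (ξ ξ' : ℂ → ℂ)
    (hinj : Set.InjOn ξ (Metric.ball a₀ r₀))
    (hderiv : ∀ a ∈ Metric.ball a₀ r₀, HasDerivAt ξ (ξ' a) a)
    (hne : ∀ a ∈ Metric.ball a₀ r₀, ξ' a ≠ 0)
    (hdist : ∀ a ∈ Metric.ball a₀ r₀, ∀ b ∈ Metric.ball a₀ r₀, ‖ξ' a / ξ' b - 1‖ ≤ ε)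
    (X : Set ℂ) (hXm : MeasurableSet X) (hX : X ⊆ ξ '' Metric.ball a₀ r₀) :
    (1 - ENNReal.ofReal ((1 + ε) ^ 2) *
        (1 - volume X / volume (ξ '' Metric.ball a₀ r₀))) * volume (Metric.ball a₀ r₀) ≤
      volume (Metric.ball a₀ r₀ ∩ ξ ⁻¹' X) := by
  set D := Metric.ball a₀ r₀
  set V := volume (ξ '' D)
  set K := ENNReal.ofReal ((1 + ε) ^ 2)
  have hD : MeasurableSet D := measurableSet_ball
  have hDtop : volume D ≠ ⊤ := measure_ball_lt_top.ne
  have hK1 : 1 ≤ K := ENNReal.one_le_ofReal.2 (by nlinarith)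
  have hpre : MeasurableSet (D ∩ ξ ⁻¹' X) := by
    have hcont : ContinuousOn ξ D := fun a ha => (hderiv a ha).continuousAt.continuousWithinAt
    have h := hD.subtype_image (hcont.domRestrict.measurable hXm)
    rwa [Set.domRestrict_eq, Set.preimage_comp, Subtype.image_preimage_coe] at h
  rcases eq_or_ne V 0 with hV0 | hV0
  · have hX0 : volume X = 0 := measure_mono_null hX hV0
    simp [hX0, tsub_eq_zero_of_le hK1]
  rcases eq_or_ne V ⊤ with hVtop | hVtop
  · simp [hVtop, tsub_eq_zero_of_le hK1]
  set A := D \ (D ∩ ξ ⁻¹' X) with hA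
  have hAm : MeasurableSet A := hD.diff hpre
  have hAD : A ⊆ D := Set.sdiff_subset
  have himage : ξ '' A = ξ '' D \ X := by
    rw [hA, Set.sdiff_self_inter]
    ext z
    constructor
    · rintro ⟨a, ⟨haD, haX⟩, rfl⟩
      exact ⟨⟨a, haD, rfl⟩, haX⟩
    · rintro ⟨⟨a, haD, rfl⟩, haX⟩
      exact ⟨a, ⟨haD, haX⟩, rfl⟩
  have hw : ∀ a ∈ D, ∀ b ∈ D,
      ENNReal.ofReal (‖ξ' a‖ ^ 2) ≤ K * ENNReal.ofReal (‖ξ' b‖ ^ 2) := by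
    intro a ha b hb
    rw [← ENNReal.ofReal_mul (by positivity), ← mul_pow]
    gcongr
    have hquot : ‖ξ' a / ξ' b‖ ≤ 1 + ε := by
      have h := norm_add_le (1 : ℂ) (ξ' a / ξ' b - 1)
      rw [add_sub_cancel, norm_one] at h
      linarith [hdist a ha b hb]
    rwa [norm_div, div_le_iff₀ (norm_pos_iff.2 (hne b hb))] at hquot
  have havg : volume A * V ≤ K * volume D * (V - volume X) := by
    have h := measure_mul_setLIntegral_le_of_le_mul hD hAm hAD ENNReal.ofReal_ne_top hDtop hw
    rwa [← volume_image_eq_lintegral_norm_deriv_sq hD hderiv hinj,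
      ← volume_image_eq_lintegral_norm_deriv_sq hAm (fun a ha => hderiv a (hAD ha))
        (hinj.mono hAD), himage,
      measure_sdiff hX hXm.nullMeasurableSet (measure_ne_top_of_subset hX hVtop)] at h
  have hA_le : volume A ≤ K * (1 - volume X / V) * volume D := by
    have hdiv : (V - volume X) / V = 1 - volume X / V := by
      rw [ENNReal.sub_div fun _ _ => hV0, ENNReal.div_self hV0 hVtop]
    calc volume A ≤ K * volume D * (V - volume X) / V :=
          (ENNReal.le_div_iff_mul_le (Or.inl hV0) (Or.inl hVtop)).2 havg
      _ = K * (1 - volume X / V) * volume D := by rw [mul_div_assoc, hdiv]; ring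
  calc (1 - K * (1 - volume X / V)) * volume D
      = volume D - K * (1 - volume X / V) * volume D := by
        rw [ENNReal.sub_mul fun _ _ => hDtop, one_mul]
    _ ≤ volume D - volume A := tsub_le_tsub_left hA_le _
    _ ≤ volume (D ∩ ξ ⁻¹' X) := by
        have h := measure_sdiff_add_inter (μ := volume) D hpre
        rw [Set.inter_eq_self_of_subset_right Set.inter_subset_left] at h
        exact tsub_le_iff_left.2 h.ge
end
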